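/- Let B = {((a, s; 0, 1/a), 0) : a ∈ ℝ∖{0}, s ∈ ℝ} ⊂ G (the upper triangular subgroup of SL(2,ℝ)) and T = {(I, v) : v ∈ ℝ²} ⊂ G. Let v_n = (α_n, β_n) ∈ ℝ² with |β_n| → ∞ and α_n/β_n → 0. If (I,v_n) B (I,v_n)⁻¹ → H in the Chabauty sense for a closed subgroup H of G, then H = T. -/

import Mathlib

open Matrix Filter Topology

/-- `SL2` is the special linear group `SL(2,ℝ)`. -/
abbrev SL2 : Type := Matrix.SpecialLinearGroup (Fin 2) ℝ

/-- `M2` is the space of 2×2 real matrices. -/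
abbrev M2 : Type := Matrix (Fin 2) (Fin 2) ℝ

noncomputable instance : TopologicalSpace SL2 :=
  TopologicalSpace.induced (fun g => (g : M2)) inferInstance

/-- Chabauty-sense convergence of a sequence of subsets of a topological space `X`:
(i) every point of the limit is a limit of a sequence of points of the `H n`;
(ii) every convergent sequence `x (k n) ∈ H (k n)` along a strictly increasing sequence
of indices has its limit in `L`. -/
def ChabautyTendsto {X : Type*} [TopologicalSpace X] (H : ℕ → Set X) (L : Set X) : Prop :=
  (∀ h ∈ L, ∃ u : ℕ → X, (∀ n, u n ∈ H n) ∧ Filter.Tendsto u Filter.atTop (nhds h)) ∧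
  (∀ k : ℕ → ℕ, StrictMono k → ∀ x : ℕ → X, (∀ n, x n ∈ H (k n)) →
    ∀ l : X, Filter.Tendsto x Filter.atTop (nhds l) → l ∈ L)

/-- Conjugate `x S x⁻¹` of a subset `S` of a group by a group element `x`. -/
def conjSet {X : Type*} [Group X] (x : X) (S : Set X) : Set X :=
  (fun s => x * s * x⁻¹) '' S

/-- The group `G = SL(2,ℝ) ⋉ ℝ²`: elements are pairs `(g, v)`. -/
structure GSL : Type where
  g : SL2
  v : Fin 2 → ℝ

namespace GSL

noncomputable instance : TopologicalSpace GSL :=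
  TopologicalSpace.induced (fun p => (p.g, p.v)) inferInstance

/-- Multiplication `(g,v)(g',v') = (gg', v + g·v')`. -/
noncomputable instance : Mul GSL :=
  ⟨fun p q => ⟨p.g * q.g, p.v + (p.g : M2) *ᵥ q.v⟩⟩

noncomputable instance : One GSL := ⟨⟨1, 0⟩⟩

noncomputable instance : Inv GSL :=
  ⟨fun p => ⟨p.g⁻¹, -((↑(p.g⁻¹) : M2) *ᵥ p.v)⟩⟩

@[simp] lemma mul_def (p q : GSL) :
    p * q = ⟨p.g * q.g, p.v + (p.g : M2) *ᵥ q.v⟩ := rfl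

@[simp] lemma one_def : (1 : GSL) = ⟨1, 0⟩ := rfl

@[simp] lemma inv_def (p : GSL) :
    p⁻¹ = ⟨p.g⁻¹, -((↑(p.g⁻¹) : M2) *ᵥ p.v)⟩ := rfl

noncomputable instance : Group GSL where
  mul_assoc a b c := by
    simp only [mul_def, GSL.mk.injEq]
    refine ⟨mul_assoc _ _ _, ?_⟩
    simp only [Matrix.SpecialLinearGroup.coe_mul, Matrix.mulVec_add, Matrix.mulVec_mulVec, add_assoc]
  one_mul a := by
    simp only [one_def, mul_def, GSL.mk.injEq]
    simp
  mul_one a := by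
    simp only [one_def, mul_def, GSL.mk.injEq]
    simp
  inv_mul_cancel a := by
    simp only [inv_def, mul_def, one_def, GSL.mk.injEq]
    exact ⟨inv_mul_cancel _, neg_add_cancel _⟩

end GSL

/-- The unipotent matrix `(1, s; 0, 1)` as an element of `SL(2,ℝ)`. -/
noncomputable def sMat (s : ℝ) : SL2 :=
  ⟨!![1, s; 0, 1], by simp [Matrix.det_fin_two_of]⟩

/-- The diagonal matrix `diag(a, 1/a)` as an element of `SL(2,ℝ)` (for `a ≠ 0`). -/
noncomputable def aMat (a : ℝ) (ha : a ≠ 0) : SL2 :=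
  ⟨!![a, 0; 0, a⁻¹], by simp [Matrix.det_fin_two_of, mul_inv_cancel₀ ha]⟩

/-- The Borel subgroup `B = {((a, s; 0, 1/a), 0) : a ≠ 0, s ∈ ℝ}` of `G`. -/
def Bset : Set GSL := {p | (∃ a s : ℝ, a ≠ 0 ∧ (p.g : M2) = !![a, s; 0, a⁻¹]) ∧ p.v = 0}

/-- The translation subgroup `T = {(I, v) : v ∈ ℝ²}` of `G`. -/
def Tset : Set GSL := {p | p.g = 1}

lemma gsl_tendsto_iff (u : ℕ → GSL) (p : GSL) :
    Tendsto u atTop (𝓝 p) ↔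
      (∀ i j, Tendsto (fun n => ((u n).g : M2) i j) atTop (𝓝 ((p.g : M2) i j))) ∧
      (∀ i, Tendsto (fun n => (u n).v i) atTop (𝓝 (p.v i))) := by
  have h1 : Topology.IsInducing (fun p : GSL => (p.g, p.v)) := ⟨rfl⟩
  have h2 : Topology.IsInducing (fun g : SL2 => (g : M2)) := ⟨rfl⟩
  rw [h1.tendsto_nhds_iff, Prod.tendsto_iff, h2.tendsto_nhds_iff]
  refine and_congr ?_ ?_
  · refine tendsto_pi_nhds.trans (forall_congr' fun i => ?_)
    exact tendsto_pi_nhds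
  · exact tendsto_pi_nhds

lemma mem_conj_iff (x y : ℝ) (p : GSL) :
    p ∈ conjSet (⟨1, ![x, y]⟩ : GSL) Bset ↔
      ∃ a s : ℝ, a ≠ 0 ∧ (p.g : M2) = !![a, s; 0, a⁻¹] ∧
        p.v 0 = (1 - a) * x - s * y ∧ p.v 1 = (1 - a⁻¹) * y := by
  constructor
  · rintro ⟨q, ⟨⟨a, s, ha, hg⟩, hv⟩, rfl⟩
    refine ⟨a, s, ha, ?_, ?_, ?_⟩
    · simp [hg]
    · simp [hg, hv, vecHead, vecTail]
      ring
    · simp [hg, hv, vecHead, vecTail]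
      ring
  · rintro ⟨a, s, ha, hg, h0, h1⟩
    refine ⟨⟨p.g, 0⟩, ⟨⟨a, s, ha, hg⟩, rfl⟩, ?_⟩
    rcases p with ⟨g, v⟩
    simp only at hg h0 h1
    simp only [GSL.mul_def, GSL.inv_def, GSL.mk.injEq]
    refine ⟨by simp, ?_⟩
    ext i
    fin_cases i
    · simp [hg, h0, vecHead, vecTail]
      ring
    · simp [hg, h1, vecHead, vecTail]
      ring

/-- If `vₙ = (αₙ, βₙ)` with `|βₙ| → ∞` and `αₙ/βₙ → 0`, and
`(I,vₙ) B (I,vₙ)⁻¹ → H` in the Chabauty sense, then `H = T = {(I, v) : v ∈ ℝ²}`. -/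
theorem borel_conj_limit_translations (α β : ℕ → ℝ)
    (hβ : Tendsto (fun n => |β n|) atTop atTop)
    (hr : Tendsto (fun n => α n / β n) atTop (𝓝 0))
    (H : Subgroup GSL) (hclosed : IsClosed (H : Set GSL))
    (hlim : ChabautyTendsto (fun n => conjSet (⟨1, ![α n, β n]⟩ : GSL) Bset) (H : Set GSL)) :
    (H : Set GSL) = Tset := by
  have hinv : Tendsto (fun n => (β n)⁻¹) atTop (𝓝 0) := by
    rw [tendsto_zero_iff_abs_tendsto_zero]
    refine hβ.inv_tendsto_atTop.congr fun n => ?_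
    simp [abs_inv]
  obtain ⟨hl1, hl2⟩ := hlim
  apply Set.Subset.antisymm
  · intro h hh
    obtain ⟨u, hu, hlimu⟩ := hl1 h hh
    rw [gsl_tendsto_iff] at hlimu
    obtain ⟨hg, hv⟩ := hlimu
    simp only [mem_conj_iff] at hu
    choose a s ha hm h0 h1 using hu
    have hne : ∀ᶠ n in atTop, β n ≠ 0 := by
      filter_upwards [hβ.eventually_gt_atTop 0] with n hn
      exact abs_pos.mp hn
    have e00 : Tendsto a atTop (𝓝 ((h.g : M2) 0 0)) := by simpa [hm] using hg 0 0
    have e01 : Tendsto s atTop (𝓝 ((h.g : M2) 0 1)) := by simpa [hm] using hg 0 1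
    have e10 : (h.g : M2) 1 0 = 0 := by
      have := hg 1 0
      simp [hm] at this
      exact this.symm
    have e11 : Tendsto (fun n => (a n)⁻¹) atTop (𝓝 ((h.g : M2) 1 1)) := by
      simpa [hm] using hg 1 1
    have g11 : (h.g : M2) 1 1 = 1 := by
      refine tendsto_nhds_unique e11 ?_
      have := (tendsto_const_nhds (x := (1 : ℝ))).sub ((hv 1).mul hinv)
      rw [mul_zero, sub_zero] at this
      refine this.congr' ?_
      filter_upwards [hne] with n hn
      rw [h1]
      field_simp
      ring
    have hdet := h.g.det_coe
    rw [Matrix.det_fin_two, e10, g11] at hdet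
    have g00 : (h.g : M2) 0 0 = 1 := by linarith
    have g01 : (h.g : M2) 0 1 = 0 := by
      refine tendsto_nhds_unique e01 ?_
      have := (((tendsto_const_nhds (x := (1 : ℝ))).sub e00).mul hr).sub ((hv 0).mul hinv)
      rw [mul_zero, mul_zero, sub_zero] at this
      refine this.congr' ?_
      filter_upwards [hne] with n hn
      rw [h0]
      field_simp
      ring
    change h.g = 1
    ext i j
    fin_cases i <;> fin_cases j <;> simp [g00, g01, e10, g11]
  · intro p hp
    obtain ⟨g, v⟩ := p
    change g = 1 at hp
    subst hp
    obtain ⟨N, hN⟩ := eventually_atTop.mp (hβ.eventually_gt_atTop |v 1|)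
    have hk : StrictMono (fun n : ℕ => n + N) := fun a b hab => Nat.add_lt_add_right hab N
    have hkt := hk.tendsto_atTop
    have hb : ∀ n, β (n + N) ≠ 0 := fun n =>
      abs_pos.mp (lt_of_le_of_lt (abs_nonneg _) (hN _ (Nat.le_add_left _ _)))
    have hc : ∀ n, 1 - v 1 * (β (n + N))⁻¹ ≠ 0 := by
      intro n h
      have h2 := hN _ (Nat.le_add_left N n)
      have h3 := hb n
      field_simp at h
      have : β (n + N) = v 1 := by linarith
      rw [this] at h2
      exact lt_irrefl _ h2
    have hinv' := hinv.comp hkt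
    have hr' := hr.comp hkt
    simp only [Function.comp_def] at hinv' hr'
    let c : ℕ → ℝ := fun n => 1 - v 1 * (β (n + N))⁻¹
    let s : ℕ → ℝ := fun n => (1 - (c n)⁻¹) * (α (n + N) / β (n + N)) - v 0 * (β (n + N))⁻¹
    have hct : Tendsto c atTop (𝓝 1) := by
      simpa using (tendsto_const_nhds (x := (1 : ℝ))).sub (hinv'.const_mul (v 1))
    have hat : Tendsto (fun n => (c n)⁻¹) atTop (𝓝 1) := by
      simpa using hct.inv₀ one_ne_zero
    have hst : Tendsto s atTop (𝓝 0) := by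
      simpa using (((tendsto_const_nhds (x := (1 : ℝ))).sub hat).mul hr').sub
        (hinv'.const_mul (v 0))
    refine hl2 _ hk (fun n => ⟨⟨!![(c n)⁻¹, s n; 0, c n], ?_⟩, v⟩) ?_ _ ?_
    · rw [Matrix.det_fin_two_of, mul_zero, sub_zero]
      exact inv_mul_cancel₀ (hc n)
    · intro n
      rw [mem_conj_iff]
      refine ⟨(c n)⁻¹, s n, inv_ne_zero (hc n), by simp, ?_, ?_⟩
      · have := hb n
        simp only [s]
        field_simp
        ring
      · have := hb n
        simp only [inv_inv, c]
        field_simp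
        ring
    · rw [gsl_tendsto_iff]
      refine ⟨fun i j => ?_, fun i => tendsto_const_nhds⟩
      fin_cases i <;> fin_cases j <;> simp [hct, hat, hst]
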